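/- Let u, m be positive integers and d an integer with 1 ≤ d ≤ u. Let S = (s_1,…,s_m) be i.i.d. uniform draws from [u], and for each i ∈ [u] let b_i^S := |{j ∈ [m] : s_j = i}|. Let T*(S) be drawn uniformly at random among all size-d subsets T ⊆ [u] that minimize Σ_{i∈T} b_i^S. Then T*(S) is uniformly distributed over all size-d subsets of [u]: for every T ⊆ [u] with |T| = d, Pr[T*(S) = T] = 1/binom(u,d). -/

import Mathlib

open Finset

/-- Number of occurrences of `i` in the sample `S` of i.i.d. uniform draws from `[u]`. -/
def occ {u m : ℕ} (S : Fin m → Fin u) (i : Fin u) : ℕ :=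
  (Finset.univ.filter (fun j => S j = i)).card

open Classical in
/-- The size-`d` subsets of `[u]` that minimize the total number of occurrences in `S`. -/
noncomputable def minimizers {u m : ℕ} (d : ℕ) (S : Fin m → Fin u) : Finset (Finset (Fin u)) :=
  (Finset.powersetCard d (Finset.univ : Finset (Fin u))).filter
    (fun T'' => ∀ T' ∈ Finset.powersetCard d (Finset.univ : Finset (Fin u)),
      ∑ i ∈ T'', occ S i ≤ ∑ i ∈ T', occ S i)

open Classical in
/-- The number of samples, weighted by the probability of choosing `T` given the sample. -/
noncomputable def choiceWeight {u : ℕ} (m d : ℕ) (T : Finset (Fin u)) : ℝ :=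
  ∑ S : Fin m → Fin u, (if T ∈ minimizers d S then (1 : ℝ) else 0) / ((minimizers d S).card : ℝ)

lemma occ_comp_perm {u m : ℕ} (σ : Equiv.Perm (Fin u)) (S : Fin m → Fin u) (i : Fin u) :
    occ (σ ∘ S) (σ i) = occ S i := by
  simp [occ]

lemma sum_occ_comp_perm {u m : ℕ} (σ : Equiv.Perm (Fin u)) (S : Fin m → Fin u)
    (T : Finset (Fin u)) :
    ∑ i ∈ T.map σ.toEmbedding, occ (σ ∘ S) i = ∑ i ∈ T, occ S i := by
  simp [Finset.sum_map, occ_comp_perm]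

lemma map_mem_minimizers_iff {u m d : ℕ} (σ : Equiv.Perm (Fin u)) (S : Fin m → Fin u)
    (T : Finset (Fin u)) :
    T.map σ.toEmbedding ∈ minimizers d (σ ∘ S) ↔ T ∈ minimizers d S := by
  simp only [minimizers, Finset.mem_filter, Finset.mem_powersetCard_univ, Finset.card_map,
    sum_occ_comp_perm]
  refine and_congr_right fun _ => ?_
  rw [← σ.finsetCongr.forall_congr_right]
  simp only [Equiv.finsetCongr_apply, Finset.card_map, sum_occ_comp_perm]

lemma card_minimizers_comp_perm {u m d : ℕ} (σ : Equiv.Perm (Fin u)) (S : Fin m → Fin u) :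
    (minimizers d (σ ∘ S)).card = (minimizers d S).card := by
  refine (Finset.card_equiv σ.finsetCongr fun T => ?_).symm
  rw [Equiv.finsetCongr_apply, map_mem_minimizers_iff]

lemma minimizers_nonempty {u m d : ℕ} (hdu : d ≤ u) (S : Fin m → Fin u) :
    (minimizers d S).Nonempty := by
  obtain ⟨T, hT, hmin⟩ := Finset.exists_min_image
    (Finset.powersetCard d (Finset.univ : Finset (Fin u))) (fun T => ∑ i ∈ T, occ S i)
    (Finset.powersetCard_nonempty.2 (by simpa using hdu))
  exact ⟨T, Finset.mem_filter.2 ⟨hT, hmin⟩⟩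

lemma choiceWeight_map_perm {u m d : ℕ} (σ : Equiv.Perm (Fin u)) (T : Finset (Fin u)) :
    choiceWeight m d (T.map σ.toEmbedding) = choiceWeight m d T := by
  unfold choiceWeight
  rw [← Equiv.sum_comp ((Equiv.refl (Fin m)).arrowCongr σ)]
  refine Finset.sum_congr rfl fun S _ => ?_
  have h : (Equiv.refl (Fin m)).arrowCongr σ S = σ ∘ S := rfl
  simp only [h, map_mem_minimizers_iff, card_minimizers_comp_perm]

lemma exists_perm_map_eq {α : Type*} [Fintype α] [DecidableEq α] {T T' : Finset α}
    (h : T.card = T'.card) : ∃ σ : Equiv.Perm α, T.map σ.toEmbedding = T' := by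
  let e : {x // x ∈ T} ≃ {x // x ∈ T'} := Finset.equivOfCardEq h
  refine ⟨e.extendSubtype, Finset.eq_of_subset_of_card_le (fun x hx => ?_) (by simp [h])⟩
  obtain ⟨y, hy, rfl⟩ := Finset.mem_map.1 hx
  exact e.extendSubtype_mem y hy

lemma choiceWeight_eq_of_card_eq {u m d : ℕ} {T T' : Finset (Fin u)} (h : T.card = T'.card) :
    choiceWeight m d T' = choiceWeight m d T := by
  obtain ⟨σ, rfl⟩ := exists_perm_map_eq h
  exact choiceWeight_map_perm σ T

lemma sum_choiceWeight {u m d : ℕ} (hdu : d ≤ u) :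
    ∑ T ∈ Finset.powersetCard d (Finset.univ : Finset (Fin u)), choiceWeight m d T =
      (u : ℝ) ^ m := by
  classical
  unfold choiceWeight
  rw [Finset.sum_comm]
  have h (S : Fin m → Fin u) :
      ∑ T ∈ Finset.powersetCard d (Finset.univ : Finset (Fin u)),
        (if T ∈ minimizers d S then (1 : ℝ) else 0) / ((minimizers d S).card : ℝ) = 1 := by
    have hsub : minimizers d S ⊆ Finset.powersetCard d (Finset.univ : Finset (Fin u)) :=
      Finset.filter_subset _ _
    have hne : ((minimizers d S).card : ℝ) ≠ 0 :=
      Nat.cast_ne_zero.2 (minimizers_nonempty hdu S).card_ne_zero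
    rw [← Finset.sum_div, Finset.sum_ite_mem, Finset.inter_eq_right.2 hsub]
    simp [hne]
  simp [h]

-- STATEMENT 8: `T*(S)`, chosen uniformly among the size-`d` subsets minimizing
-- `∑_{i ∈ T} b_i^S` of an i.i.d. uniform sample `S`, is uniform over all size-`d` subsets.
open Classical in
theorem minimizing_subset_uniform (u m d : ℕ) (hu : 0 < u) (hm : 0 < m)
    (hd1 : 1 ≤ d) (hdu : d ≤ u) (T : Finset (Fin u)) (hT : T.card = d) :
    (∑ S : Fin m → Fin u,
        (if T ∈ (Finset.powersetCard d (Finset.univ : Finset (Fin u))).filter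
              (fun T'' => ∀ T' ∈ Finset.powersetCard d (Finset.univ : Finset (Fin u)),
                ∑ i ∈ T'', occ S i ≤ ∑ i ∈ T', occ S i)
          then (1 : ℝ) else 0) /
          (((Finset.powersetCard d (Finset.univ : Finset (Fin u))).filter
              (fun T'' => ∀ T' ∈ Finset.powersetCard d (Finset.univ : Finset (Fin u)),
                ∑ i ∈ T'', occ S i ≤ ∑ i ∈ T', occ S i)).card : ℝ)) /
      (u : ℝ) ^ m = 1 / (u.choose d : ℝ) := by
  change choiceWeight m d T / (u : ℝ) ^ m = 1 / (u.choose d : ℝ)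
  have hsum : (u.choose d : ℝ) * choiceWeight m d T = (u : ℝ) ^ m := by
    rw [← sum_choiceWeight (m := m) hdu, Finset.sum_congr rfl fun T' hT' =>
      choiceWeight_eq_of_card_eq (hT.trans (Finset.mem_powersetCard_univ.1 hT').symm)]
    simp
  have hu' : (u : ℝ) ^ m ≠ 0 := by positivity
  have hc : (u.choose d : ℝ) ≠ 0 := Nat.cast_ne_zero.2 (Nat.choose_pos hdu).ne'
  rw [div_eq_div_iff hu' hc, one_mul, mul_comm, hsum]
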